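/- Let w be a fixed point of w = H_λ(w − Gᵀ(Gw − b)) with S = supp(w), and let P_S^⊥ denote the orthogonal projection onto the orthogonal complement of the column span of G_S. Then for any perturbation η with supp(η) ⊆ S and ‖η‖_∞ < λ, the objective F(v) = (1/2)‖Gv − b‖₂² + (λ²/2)‖v‖₀ satisfies F(w + η) − F(w) = (1/2)‖Gη‖₂² ≥ 0. -/

import Mathlib

open Finset
open scoped Classical BigOperators symmDiff

/-- Euclidean (ℓ²) norm of a vector in `ℝⁿ`. -/
noncomputable def norm2 {n : ℕ} (x : Fin n → ℝ) : ℝ := Real.sqrt (∑ i, (x i)^2)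

/-- Support of a vector: the set of indices with nonzero entries. -/
noncomputable def supp {n : ℕ} (x : Fin n → ℝ) : Finset (Fin n) :=
  Finset.univ.filter (fun i => x i ≠ 0)

/-- Hard thresholding operator with threshold `lam`. -/
noncomputable def Hthr {n : ℕ} (lam : ℝ) (x : Fin n → ℝ) : Fin n → ℝ :=
  fun i => if lam ≤ |x i| then x i else 0

open scoped Matrix

/-- For a fixed point `w` and a perturbation `η` supported on `supp w` with
`‖η‖∞ < λ`, the objective changes by exactly `(1/2)‖Gη‖₂² ≥ 0`. -/
theorem stmt_6 {m n : ℕ} (G : Matrix (Fin m) (Fin n) ℝ) (b : Fin m → ℝ) (lam : ℝ)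
    (hlam : 0 < lam) (w : Fin n → ℝ)
    (hfix : w = Hthr lam (w - G.transpose.mulVec (G.mulVec w - b)))
    (F : (Fin n → ℝ) → ℝ)
    (hF : ∀ v, F v = (1/2) * (norm2 (G.mulVec v - b))^2 + lam^2/2 * ((supp v).card : ℝ))
    (η : Fin n → ℝ) (hsupp : supp η ⊆ supp w) (hinf : ∀ i, |η i| < lam) :
    F (w + η) - F w = (1/2) * (norm2 (G.mulVec η))^2 ∧
      0 ≤ (1/2) * (norm2 (G.mulVec η))^2 := by
  have key : ∀ i, w i ≠ 0 → lam ≤ |w i| ∧ G.transpose.mulVec (G.mulVec w - b) i = 0 := by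
    intro i hi
    have h := congrFun hfix i
    simp only [Hthr, Pi.sub_apply] at h
    split_ifs at h with hc
    · have h0 : G.transpose.mulVec (G.mulVec w - b) i = 0 := by linarith
      rw [h0, sub_zero] at hc
      exact ⟨hc, h0⟩
    · exact absurd h hi
  have hη : ∀ i, w i = 0 → η i = 0 := by
    intro i hi
    by_contra hne
    have h1 : i ∈ supp η := by simp [supp, hne]
    have h2 := hsupp h1
    simp [supp, hi] at h2
  have hs : supp (w + η) = supp w := by
    ext i
    simp only [supp, Finset.mem_filter, Finset.mem_univ, true_and, Pi.add_apply]
    constructor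
    · intro h hi
      exact h (by rw [hi, hη i hi, add_zero])
    · intro hi h
      have h1 := (key i hi).1
      have h2 := hinf i
      have h3 : w i = - η i := by linarith
      rw [h3, abs_neg] at h1
      linarith
  have hn : ∀ {k : ℕ} (x : Fin k → ℝ), norm2 x ^ 2 = x ⬝ᵥ x := by
    intro k x
    rw [norm2, Real.sq_sqrt (Finset.sum_nonneg fun i _ => sq_nonneg _)]
    simp [dotProduct, sq]
  have hcross : (G.mulVec w - b) ⬝ᵥ G.mulVec η = 0 := by
    rw [Matrix.dotProduct_mulVec, ← Matrix.mulVec_transpose]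
    apply Finset.sum_eq_zero
    intro i _
    by_cases hi : w i = 0
    · rw [hη i hi, mul_zero]
    · rw [(key i hi).2, zero_mul]
  refine ⟨?_, by positivity⟩
  have he : G.mulVec (w + η) - b = (G.mulVec w - b) + G.mulVec η := by
    rw [Matrix.mulVec_add]; abel
  rw [hF, hF, hs, he, hn, hn, hn, add_dotProduct, dotProduct_add, dotProduct_add,
    dotProduct_comm (G.mulVec η) (G.mulVec w - b), hcross]
  ring
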